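/- Let O be a measurable space, let P and P̄ be probability measures on O, and let H ≥ 1 be an integer. For each o ∈ O let R(·|o) = ⊗_{h=1}^H R_h(·|o) and R̄(·|o) = ⊗_{h=1}^H R̄_h(·|o) be Markov kernels from O to ℝ^H that are products of coordinate distributions, each coordinate distribution supported on [0,1]; write R(o) := (E_{r∼R_h(·|o)}[r])_{h=1}^H ∈ [0,1]^H and R̄(o) := (E_{r∼R̄_h(·|o)}[r])_{h=1}^H for the mean-reward vectors. Assume ‖R(o) − R̄(o)‖_2^2 ≤ 2 for all o ∈ O. Then D_H^2(P, P̄) + E_{o∼P}[ ‖R(o) − R̄(o)‖_2^2 ] ≤ 5 · D_H^2( R ⊗ P, R̄ ⊗ P̄ ), where R ⊗ P denotes the joint law on O × ℝ^H of (o, r) with o ∼ P and r ∼ R(·|o). -/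

import Mathlib

open MeasureTheory ProbabilityTheory

noncomputable section

/-- Squared Hellinger distance between two measures, computed with respect to the
(dominating) measure `P + Q`. -/
def hellingerSq {Ω : Type*} [MeasurableSpace Ω] (P Q : Measure Ω) : ℝ :=
  ∫ x, (Real.sqrt ((P.rnDeriv (P + Q) x).toReal)
      - Real.sqrt ((Q.rnDeriv (P + Q) x).toReal)) ^ 2 ∂(P + Q)

/-- Integrability of the Hellinger integrand. -/
lemma hell_integrable {Ω : Type*} [MeasurableSpace Ω] (M N : Measure Ω)
    [IsProbabilityMeasure M] [IsProbabilityMeasure N] :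
    Integrable (fun x => (Real.sqrt ((M.rnDeriv (M + N) x).toReal)
      - Real.sqrt ((N.rnDeriv (M + N) x).toReal)) ^ 2) (M + N) := by
  have h1 : Integrable (fun x => (M.rnDeriv (M + N) x).toReal) (M + N) :=
    Measure.integrable_toReal_rnDeriv
  have h2 : Integrable (fun x => (N.rnDeriv (M + N) x).toReal) (M + N) :=
    Measure.integrable_toReal_rnDeriv
  refine (h1.add h2).mono' (by fun_prop) (Filter.Eventually.of_forall fun x => ?_)
  have a0 : 0 ≤ (M.rnDeriv (M + N) x).toReal := ENNReal.toReal_nonneg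
  have b0 : 0 ≤ (N.rnDeriv (M + N) x).toReal := ENNReal.toReal_nonneg
  rw [Real.norm_of_nonneg (sq_nonneg _)]
  simp only [Pi.add_apply]
  nlinarith [Real.sq_sqrt a0, Real.sq_sqrt b0,
    mul_nonneg (Real.sqrt_nonneg (M.rnDeriv (M + N) x).toReal)
      (Real.sqrt_nonneg (N.rnDeriv (M + N) x).toReal)]

/-- Change of measure for the variational functional. -/
lemma functional_eq {Ω : Type*} [MeasurableSpace Ω] (M N : Measure Ω)
    [IsProbabilityMeasure M] [IsProbabilityMeasure N] (u : Ω → ℝ)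
    (hu : Integrable u M) (hu' : Integrable (fun x => (u x)⁻¹) N) :
    Integrable (fun x => (M.rnDeriv (M + N) x).toReal * (1 - u x)
      + (N.rnDeriv (M + N) x).toReal * (1 - (u x)⁻¹)) (M + N) ∧
    ∫ x, ((M.rnDeriv (M + N) x).toReal * (1 - u x)
      + (N.rnDeriv (M + N) x).toReal * (1 - (u x)⁻¹)) ∂(M + N)
      = 2 - ∫ x, u x ∂M - ∫ x, (u x)⁻¹ ∂N := by
  have hM : M ≪ M + N := Measure.absolutelyContinuous_of_le (Measure.le_add_right le_rfl)
  have hN : N ≪ M + N := Measure.absolutelyContinuous_of_le (Measure.le_add_left le_rfl)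
  have i1 : Integrable (fun x => 1 - u x) M := (integrable_const 1).sub hu
  have i2 : Integrable (fun x => 1 - (u x)⁻¹) N := (integrable_const 1).sub hu'
  have j1 := (integrable_rnDeriv_smul_iff hM).2 i1
  have j2 := (integrable_rnDeriv_smul_iff hN).2 i2
  simp only [smul_eq_mul] at j1 j2
  refine ⟨j1.add j2, ?_⟩
  rw [integral_add j1 j2]
  have e1 := integral_rnDeriv_smul (f := fun x => 1 - u x) hM
  have e2 := integral_rnDeriv_smul (f := fun x => 1 - (u x)⁻¹) hN
  simp only [smul_eq_mul] at e1 e2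
  rw [e1, e2, integral_sub (integrable_const 1) hu, integral_sub (integrable_const 1) hu']
  simp
  ring

/-- Variational lower bound on the squared Hellinger distance. -/
lemma hell_variational {Ω : Type*} [MeasurableSpace Ω] (M N : Measure Ω)
    [IsProbabilityMeasure M] [IsProbabilityMeasure N] (u : Ω → ℝ) (hpos : ∀ x, 0 < u x)
    (hu : Integrable u M) (hu' : Integrable (fun x => (u x)⁻¹) N) :
    2 - ∫ x, u x ∂M - ∫ x, (u x)⁻¹ ∂N ≤ hellingerSq M N := by
  obtain ⟨hi, he⟩ := functional_eq M N u hu hu'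
  rw [← he]
  refine integral_mono hi (hell_integrable M N) fun x => ?_
  have a0 : 0 ≤ (M.rnDeriv (M + N) x).toReal := ENNReal.toReal_nonneg
  have b0 : 0 ≤ (N.rnDeriv (M + N) x).toReal := ENNReal.toReal_nonneg
  simp only
  generalize (M.rnDeriv (M + N) x).toReal = a at *
  generalize (N.rnDeriv (M + N) x).toReal = b at *
  obtain ⟨s, hs, rfl⟩ : ∃ s, 0 ≤ s ∧ a = s ^ 2 := ⟨√a, Real.sqrt_nonneg _, (Real.sq_sqrt a0).symm⟩
  obtain ⟨t, ht, rfl⟩ : ∃ s, 0 ≤ s ∧ b = s ^ 2 := ⟨√b, Real.sqrt_nonneg _, (Real.sq_sqrt b0).symm⟩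
  rw [Real.sqrt_sq hs, Real.sqrt_sq ht]
  have hx := hpos x
  have key : 0 ≤ (u x)⁻¹ * (u x * s - t) ^ 2 := by positivity
  have : (u x)⁻¹ * (u x * s - t) ^ 2 = s ^ 2 * u x - 2 * s * t + t ^ 2 * (u x)⁻¹ := by
    field_simp
    ring
  nlinarith

lemma sqrt_aux {p q e : ℝ} (hp : 0 ≤ p) (hp1 : p ≤ 1) (hq : 0 ≤ q) (he : 0 < e) :
    p * (√(q + e) / √(p + e)) ≤ √p * √q + √e := by
  have h1 : √(q + e) ≤ √q + √e := by
    refine Real.sqrt_le_iff.2 ⟨by positivity, ?_⟩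
    nlinarith [Real.sq_sqrt hq, Real.sq_sqrt he.le,
      mul_nonneg (Real.sqrt_nonneg q) (Real.sqrt_nonneg e)]
  have h2 : √p ≤ √(p + e) := Real.sqrt_le_sqrt (by linarith)
  have h3 : 0 < √(p + e) := Real.sqrt_pos.2 (by linarith)
  have h4 : √p ≤ 1 := Real.sqrt_le_one.2 hp1
  have h5 := Real.sqrt_nonneg p
  have h6 := Real.sqrt_nonneg e
  have h7 := Real.sqrt_nonneg (q + e)
  rw [mul_div_assoc', div_le_iff₀ h3]
  calc p * √(q + e) = √p * √(q + e) * √p := by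
        nth_rw 1 [← Real.mul_self_sqrt hp]; ring
    _ ≤ √p * √(q + e) * √(p + e) := by gcongr
    _ ≤ (√p * √q + √e) * √(p + e) := by
        gcongr
        nlinarith

lemma quot_bound {p q e : ℝ} (hp : 0 ≤ p) (hq1 : q ≤ 1) (he : 0 < e) :
    √(q + e) / √(p + e) ≤ √(1 + e) / √e := by
  have : 0 < √e := Real.sqrt_pos.2 he
  gcongr
  linarith

/-- Data processing for the first marginal. -/
lemma hell_fst_le {O E : Type*} [MeasurableSpace O] [MeasurableSpace E]
    (P Q : Measure O) [IsProbabilityMeasure P] [IsProbabilityMeasure Q]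
    (M N : Measure (O × E)) [IsProbabilityMeasure M] [IsProbabilityMeasure N]
    (hM : M.fst = P) (hN : N.fst = Q) :
    hellingerSq P Q ≤ hellingerSq M N := by
  have main : ∀ e : ℝ, 0 < e → hellingerSq P Q - 4 * √e ≤ hellingerSq M N := by
    intro e he
    set p : O → ℝ := fun x => (P.rnDeriv (P + Q) x).toReal with hp
    set q : O → ℝ := fun x => (Q.rnDeriv (P + Q) x).toReal with hq
    have p0 : ∀ x, 0 ≤ p x := fun x => ENNReal.toReal_nonneg
    have q0 : ∀ x, 0 ≤ q x := fun x => ENNReal.toReal_nonneg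
    have hPle : P ≤ P + Q := Measure.le_add_right le_rfl
    have hQle : Q ≤ P + Q := Measure.le_add_left le_rfl
    have p1 : ∀ᵐ x ∂(P + Q), p x ≤ 1 := by
      filter_upwards [Measure.rnDeriv_le_one_of_le hPle] with x hx
      exact ENNReal.toReal_le_of_le_ofReal zero_le_one (by simpa using hx)
    have q1 : ∀ᵐ x ∂(P + Q), q x ≤ 1 := by
      filter_upwards [Measure.rnDeriv_le_one_of_le hQle] with x hx
      exact ENNReal.toReal_le_of_le_ofReal zero_le_one (by simpa using hx)
    have mp : Measurable p := by fun_prop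
    have mq : Measurable q := by fun_prop
    set u : O → ℝ := fun x => √(q x + e) / √(p x + e) with hu
    have mu : Measurable u := by fun_prop
    have sp : ∀ x, 0 < √(p x + e) := fun x => Real.sqrt_pos.2 (by linarith [p0 x])
    have sq : ∀ x, 0 < √(q x + e) := fun x => Real.sqrt_pos.2 (by linarith [q0 x])
    have upos : ∀ x, 0 < u x := fun x => div_pos (sq x) (sp x)
    have iu : Integrable u P := by
      refine Integrable.of_bound mu.aestronglyMeasurable (√(1 + e) / √e) ?_
      filter_upwards [(Measure.absolutelyContinuous_of_le hPle).ae_le q1] with x hx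
      rw [Real.norm_of_nonneg (upos x).le]
      exact quot_bound (p0 x) hx he
    have iu' : Integrable (fun x => (u x)⁻¹) Q := by
      refine Integrable.of_bound mu.inv.aestronglyMeasurable (√(1 + e) / √e) ?_
      filter_upwards [(Measure.absolutelyContinuous_of_le hQle).ae_le p1] with x hx
      rw [Real.norm_of_nonneg (inv_pos.2 (upos x)).le, hu, inv_div]
      exact quot_bound (q0 x) hx he
    have l1 : ∫ z, u z.1 ∂M = ∫ x, u x ∂P := by
      rw [← hM, Measure.fst, integral_map measurable_fst.aemeasurable mu.aestronglyMeasurable]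
    have l2 : ∫ z, (u z.1)⁻¹ ∂N = ∫ x, (u x)⁻¹ ∂Q := by
      rw [← hN, Measure.fst, integral_map measurable_fst.aemeasurable (f := fun x => (u x)⁻¹)
        mu.inv.aestronglyMeasurable]
    have k1 : Integrable (fun z : O × E => u z.1) M := by
      rw [← hM] at iu
      exact iu.comp_measurable measurable_fst
    have k2 : Integrable (fun z : O × E => (u z.1)⁻¹) N := by
      rw [← hN] at iu'
      exact iu'.comp_measurable measurable_fst
    have hv := hell_variational M N (fun z => u z.1) (fun z => upos z.1) k1 k2
    rw [l1, l2] at hv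
    refine le_trans ?_ hv
    obtain ⟨hi, heq⟩ := functional_eq P Q u iu iu'
    rw [← heq]
    have hc : ∫ x, (2 * √e : ℝ) ∂(P + Q) = 4 * √e := by
      rw [integral_const]
      simp [Measure.real]
      ring_nf
      norm_num
      try ring
    rw [hellingerSq, ← hc, ← integral_sub (hell_integrable P Q) (integrable_const _)]
    refine integral_mono_ae ((hell_integrable P Q).sub (integrable_const _)) hi ?_
    filter_upwards [p1, q1] with x hx1 hx2
    have b1 := sqrt_aux (p0 x) hx1 (q0 x) he
    have b2 := sqrt_aux (q0 x) hx2 (p0 x) he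
    have hinv : (u x)⁻¹ = √(p x + e) / √(q x + e) := by rw [hu, inv_div]
    change (√(p x) - √(q x)) ^ 2 - 2 * √e ≤ p x * (1 - u x) + q x * (1 - (u x)⁻¹)
    rw [hinv]
    change (√(p x) - √(q x)) ^ 2 - 2 * √e ≤ p x * (1 - √(q x + e) / √(p x + e)) + _
    nlinarith [Real.sq_sqrt (p0 x), Real.sq_sqrt (q0 x)]
  refine le_of_forall_pos_le_add fun d hd => ?_
  have := main ((d / 4) ^ 2) (by positivity)
  rw [Real.sqrt_sq (by positivity)] at this
  linarith

/-- Hoeffding's lemma on `[0,1]`. -/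
lemma hoeff_one (ρ : Measure ℝ) [IsProbabilityMeasure ρ]
    (hs : ρ (Set.Icc (0 : ℝ) 1)ᶜ = 0) (t c : ℝ) :
    ∫ r, Real.exp (t * (r - c)) ∂ρ ≤ Real.exp (t * ((∫ r, r ∂ρ) - c) + t ^ 2 / 8) := by
  have hb : ∀ᵐ r ∂ρ, (fun r : ℝ => r) r ∈ Set.Icc (0 : ℝ) 1 := hs
  have h := (hasSubgaussianMGF_of_mem_Icc (X := fun r : ℝ => r) aemeasurable_id' hb).mgf_le t
  have e : ∀ r : ℝ, Real.exp (t * (r - c))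
      = Real.exp (t * ((∫ r, r ∂ρ) - c)) * Real.exp (t * (r - ∫ r, r ∂ρ)) := by
    intro r
    rw [← Real.exp_add]
    ring_nf
  rw [integral_congr_ae (Filter.Eventually.of_forall e), integral_const_mul, Real.exp_add]
  gcongr
  refine h.trans (Real.exp_le_exp.2 (le_of_eq ?_))
  simp
  ring

lemma hoeff_pi {H : ℕ} (ρ : Fin H → Measure ℝ) (hp : ∀ h, IsProbabilityMeasure (ρ h))
    (hs : ∀ h, ρ h (Set.Icc (0 : ℝ) 1)ᶜ = 0) (t c : Fin H → ℝ) :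
    ∫ r, Real.exp (∑ h, t h * (r h - c h)) ∂(Measure.pi ρ)
      ≤ Real.exp (∑ h, (t h * ((∫ r, r ∂(ρ h)) - c h) + t h ^ 2 / 8)) := by
  simp_rw [Real.exp_sum]
  rw [integral_fintype_prod_eq_prod (𝕜 := ℝ) (fun h r => Real.exp (t h * (r - c h)))]
  refine Finset.prod_le_prod (fun h _ => integral_nonneg fun r => (Real.exp_pos _).le) ?_
  intro h _
  exact hoeff_one (ρ h) (hs h) (t h) (c h)

lemma mean_mem (ρ : Measure ℝ) [IsProbabilityMeasure ρ]
    (hs : ρ (Set.Icc (0 : ℝ) 1)ᶜ = 0) : 0 ≤ ∫ r, r ∂ρ ∧ ∫ r, r ∂ρ ≤ 1 := by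
  have hb : ∀ᵐ r ∂ρ, r ∈ Set.Icc (0 : ℝ) 1 := hs
  have hi : Integrable (fun r : ℝ => r) ρ := Integrable.of_mem_Icc 0 1 aemeasurable_id' hb
  refine ⟨integral_nonneg_of_ae (hb.mono fun r hr => hr.1), ?_⟩
  calc ∫ r, r ∂ρ ≤ ∫ r, (1 : ℝ) ∂ρ :=
        integral_mono_ae hi (integrable_const _) (hb.mono fun r hr => hr.2)
    _ = 1 := by simp

lemma exp_neg_le_aux {x : ℝ} (h0 : 0 ≤ x) (h2 : x ≤ 2) : Real.exp (-x) ≤ 1 - x / 4 := by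
  rw [Real.exp_neg]
  have h := Real.add_one_le_exp x
  rw [inv_le_iff_one_le_mul₀ (Real.exp_pos x)]
  nlinarith

/-- Measurability of the mean reward. -/
lemma mean_measurable {O : Type*} [MeasurableSpace O] {H : ℕ} (κ : Kernel O (Fin H → ℝ))
    [IsMarkovKernel κ] (ρ : O → Fin H → Measure ℝ)
    (hρ : ∀ o h, IsProbabilityMeasure (ρ o h)) (hκ : ∀ o, κ o = Measure.pi (ρ o))
    (h : Fin H) : Measurable fun o => ∫ r, r ∂(ρ o h) := by
  have e : ∀ o, ∫ r, r ∂(ρ o h) = ∫ r, r h ∂(κ o) := by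
    intro o
    rw [hκ o]
    have := (measurePreserving_eval (ρ o) h)
    rw [← this.map_eq, integral_map (measurable_pi_apply h).aemeasurable
      (by fun_prop)]
  simp_rw [e]
  exact (StronglyMeasurable.integral_kernel (κ := κ)
    (measurable_pi_apply h).stronglyMeasurable).measurable

lemma exp_integrable {O : Type*} [MeasurableSpace O] {H : ℕ} (P : Measure O)
    [IsProbabilityMeasure P] (κ : Kernel O (Fin H → ℝ))
    [IsMarkovKernel κ] (ρ : O → Fin H → Measure ℝ)
    (hρ : ∀ o h, IsProbabilityMeasure (ρ o h)) (hκ : ∀ o, κ o = Measure.pi (ρ o))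
    (hs : ∀ o h, (ρ o h) (Set.Icc (0 : ℝ) 1)ᶜ = 0)
    (t c : O → Fin H → ℝ) (mt : ∀ h, Measurable fun o => t o h)
    (mc : ∀ h, Measurable fun o => c o h) (bt : ∀ o h, |t o h| ≤ 2)
    (bc : ∀ o h, |c o h| ≤ 2) :
    Integrable (fun z : O × (Fin H → ℝ) => Real.exp (∑ h, t z.1 h * (z.2 h - c z.1 h)))
      (P ⊗ₘ κ) := by
  have ms : Measurable fun z : O × (Fin H → ℝ) => ∑ h, t z.1 h * (z.2 h - c z.1 h) := by
    refine Finset.measurable_sum _ fun h _ => ?_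
    exact ((mt h).comp measurable_fst).mul
      (((measurable_pi_apply h).comp measurable_snd).sub ((mc h).comp measurable_fst))
  refine Integrable.of_bound ms.exp.aestronglyMeasurable (Real.exp (∑ _h : Fin H, 6)) ?_
  have hae : ∀ᵐ z ∂(P ⊗ₘ κ), ∀ h, z.2 h ∈ Set.Icc (0 : ℝ) 1 := by
    refine Measure.ae_compProd_of_ae_ae ?_ (Filter.Eventually.of_forall fun o => ?_)
    · simp only [Set.ofPred_forall]
      exact MeasurableSet.iInter fun h =>
        ((measurable_pi_apply h).comp measurable_snd) measurableSet_Icc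
    · rw [hκ o]
      refine Filter.eventually_all.2 fun h => ?_
      exact (Measure.tendsto_eval_ae_ae (μ := ρ o) (i := h)).eventually (hs o h)
  filter_upwards [hae] with z hz
  rw [Real.norm_of_nonneg (Real.exp_pos _).le]
  refine Real.exp_le_exp.2 (Finset.sum_le_sum fun h _ => ?_)
  refine (le_abs_self _).trans ?_
  rw [abs_mul]
  have h1 : |z.2 h - c z.1 h| ≤ 3 := by
    have := abs_le.1 (bc z.1 h)
    have := hz h
    rw [abs_le]
    constructor <;> linarith [this.1, this.2]
  nlinarith [bt z.1 h, abs_nonneg (t z.1 h), abs_nonneg (z.2 h - c z.1 h)]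

lemma integrable_inner {O E : Type*} [MeasurableSpace O] [MeasurableSpace E] {P : Measure O}
    [IsProbabilityMeasure P] {κ : Kernel O E} [IsMarkovKernel κ] {f : O × E → ℝ}
    (hf : Integrable f (P ⊗ₘ κ)) : Integrable (fun o => ∫ r, f (o, r) ∂(κ o)) P :=
  Integrable.integral_compProd (κ := Kernel.const Unit P) (η := Kernel.prodMkLeft Unit κ)
    (a := ()) hf

/-- Proposition (modified-to-true): the divergence `D_RL²` (squared Hellinger distance of
the observation laws plus the expected squared ℓ₂-distance of the mean-reward vectors) is
at most `5` times the squared Hellinger distance of the full joint laws of `(o, r)`. -/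
theorem DRL_sq_le_five_mul_hellingerSq
    {O : Type*} [MeasurableSpace O] (H : ℕ) (hH : 1 ≤ H)
    (P Pbar : Measure O) [IsProbabilityMeasure P] [IsProbabilityMeasure Pbar]
    -- the reward kernels, which are coordinatewise products
    (κ κbar : Kernel O (Fin H → ℝ)) [IsMarkovKernel κ] [IsMarkovKernel κbar]
    (ρ ρbar : O → Fin H → Measure ℝ)
    (hρ : ∀ o h, IsProbabilityMeasure (ρ o h))
    (hρbar : ∀ o h, IsProbabilityMeasure (ρbar o h))
    (hκ : ∀ o, κ o = Measure.pi (ρ o))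
    (hκbar : ∀ o, κbar o = Measure.pi (ρbar o))
    -- each coordinate reward distribution is supported on [0,1]
    (hρsupp : ∀ o h, (ρ o h) (Set.Icc (0 : ℝ) 1)ᶜ = 0)
    (hρbarsupp : ∀ o h, (ρbar o h) (Set.Icc (0 : ℝ) 1)ᶜ = 0)
    -- mean-reward vectors
    (R Rbar : O → Fin H → ℝ)
    (hR : ∀ o h, R o h = ∫ r, r ∂(ρ o h))
    (hRbar : ∀ o h, Rbar o h = ∫ r, r ∂(ρbar o h))
    (hbound : ∀ o, ∑ h, (R o h - Rbar o h) ^ 2 ≤ 2) :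
    hellingerSq P Pbar + ∫ o, (∑ h, (R o h - Rbar o h) ^ 2) ∂P
      ≤ 5 * hellingerSq (P ⊗ₘ κ) (Pbar ⊗ₘ κbar) := by
  have bR : ∀ o h, 0 ≤ R o h ∧ R o h ≤ 1 := fun o h => by
    have := hρ o h
    rw [hR]; exact mean_mem _ (hρsupp o h)
  have bRb : ∀ o h, 0 ≤ Rbar o h ∧ Rbar o h ≤ 1 := fun o h => by
    have := hρbar o h
    rw [hRbar]; exact mean_mem _ (hρbarsupp o h)
  have mR : ∀ h, Measurable fun o => R o h := fun h => by
    simp_rw [hR]; exact mean_measurable κ ρ hρ hκ h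
  have mRb : ∀ h, Measurable fun o => Rbar o h := fun h => by
    simp_rw [hRbar]; exact mean_measurable κbar ρbar hρbar hκbar h
  have hmarg : hellingerSq P Pbar ≤ hellingerSq (P ⊗ₘ κ) (Pbar ⊗ₘ κbar) :=
    hell_fst_le P Pbar _ _ (Measure.fst_compProd P κ) (Measure.fst_compProd Pbar κbar)
  set t : O → Fin H → ℝ := fun o h => -2 * (R o h - Rbar o h) with ht
  set c : O → Fin H → ℝ := fun o h => Rbar o h + (R o h - Rbar o h) / 4 with hc
  have mt : ∀ h, Measurable fun o => t o h := fun h => ((mR h).sub (mRb h)).const_mul _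
  have mc : ∀ h, Measurable fun o => c o h :=
    fun h => (mRb h).add (((mR h).sub (mRb h)).div_const _)
  have bt : ∀ o h, |t o h| ≤ 2 := fun o h => by
    have := bR o h
    have := bRb o h
    simp only [ht]
    rw [abs_le]
    constructor <;> linarith
  have bc : ∀ o h, |c o h| ≤ 2 := fun o h => by
    have := bR o h
    have := bRb o h
    simp only [hc]
    rw [abs_le]
    constructor <;> linarith
  have i1 := exp_integrable P κ ρ hρ hκ hρsupp t c mt mc bt bc
  have i2 := exp_integrable Pbar κbar ρbar hρbar hκbar hρbarsupp (fun o h => - t o h) c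
    (fun h => (mt h).neg) mc (fun o h => by rw [abs_neg]; exact bt o h) bc
  have einv : ∀ z : O × (Fin H → ℝ), (Real.exp (∑ h, t z.1 h * (z.2 h - c z.1 h)))⁻¹
      = Real.exp (∑ h, (- t z.1 h) * (z.2 h - c z.1 h)) := by
    intro z
    rw [← Real.exp_neg, ← Finset.sum_neg_distrib]
    simp only [neg_mul]
  have hv := hell_variational (P ⊗ₘ κ) (Pbar ⊗ₘ κbar)
    (fun z => Real.exp (∑ h, t z.1 h * (z.2 h - c z.1 h))) (fun z => Real.exp_pos _) i1
    (by simp_rw [einv]; exact i2)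
  simp_rw [einv] at hv
  have mδ : Measurable fun o => ∑ h, (R o h - Rbar o h) ^ 2 :=
    Finset.measurable_sum _ fun h _ => ((mR h).sub (mRb h)).pow_const 2
  have δ0 : ∀ o, 0 ≤ ∑ h, (R o h - Rbar o h) ^ 2 :=
    fun o => Finset.sum_nonneg fun h _ => sq_nonneg _
  have iδ : Integrable (fun o => ∑ h, (R o h - Rbar o h) ^ 2) P :=
    Integrable.of_bound mδ.aestronglyMeasurable 2 (Filter.Eventually.of_forall fun o => by
      rw [Real.norm_of_nonneg (δ0 o)]; exact hbound o)
  have e1 : ∫ z, Real.exp (∑ h, t z.1 h * (z.2 h - c z.1 h)) ∂(P ⊗ₘ κ)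
      ≤ 1 - (∫ o, (∑ h, (R o h - Rbar o h) ^ 2) ∂P) / 4 := by
    rw [Measure.integral_compProd i1]
    calc _ ≤ ∫ o, (1 - (∑ h, (R o h - Rbar o h) ^ 2) / 4) ∂P := by
          refine integral_mono (integrable_inner i1)
            ((integrable_const _).sub (iδ.div_const _)) fun o => ?_
          refine le_trans ?_ (exp_neg_le_aux (δ0 o) (hbound o))
          simp only
          rw [hκ o]
          refine (hoeff_pi (ρ o) (hρ o) (hρsupp o) (t o) (c o)).trans
            (Real.exp_le_exp.2 (le_of_eq ?_))
          rw [← Finset.sum_neg_distrib]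
          refine Finset.sum_congr rfl fun h _ => ?_
          rw [← hR]
          simp only [ht, hc]
          ring
      _ = _ := by
          rw [integral_sub (integrable_const _) (iδ.div_const _), integral_div]
          simp
  have e2 : ∫ z, Real.exp (∑ h, (- t z.1 h) * (z.2 h - c z.1 h)) ∂(Pbar ⊗ₘ κbar) ≤ 1 := by
    rw [Measure.integral_compProd i2]
    calc _ ≤ ∫ o, (1 : ℝ) ∂Pbar := by
          refine integral_mono (integrable_inner i2) (integrable_const _) fun o => ?_
          simp only
          rw [hκbar o]
          refine (hoeff_pi (ρbar o) (hρbar o) (hρbarsupp o) (fun h => - t o h) (c o)).trans ?_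
          rw [Real.exp_le_one_iff]
          refine le_of_eq (Finset.sum_eq_zero fun h _ => ?_)
          rw [← hRbar]
          simp only [ht, hc]
          ring
      _ = 1 := by simp
  linarith
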